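/- arXiv:2003.09196 — 2 statements merged into one kernel-verified Lean document; each statement's English description precedes it below -/
import Mathlib

section
/- Let α > 0 and let S ⊆ ℍ be a topological surface with the α-flat cone property. Then for every o ∈ S there exists an open neighborhood U ⊆ ℍ of o such that for all p ∈ S ∩ U one has C(α/4) ∩ p⁻¹(S ∩ U) = ∅; in particular, S has locally the (α/4)-full cone property. -/
open Set

noncomputable section

/-- The first Heisenberg group as ℝ³. -/
abbrev H : Type := ℝ × ℝ × ℝ

/-- Heisenberg group multiplication. -/
def Hmul (p q : H) : H :=
  (p.1 + q.1, p.2.1 + q.2.1, p.2.2 + q.2.2 + (p.1 * q.2.1 - q.1 * p.2.1) / 2)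

/-- Heisenberg group inverse. -/
def Hinv (p : H) : H := (-p.1, -p.2.1, -p.2.2)

/-- Left translation of a set: `pE = {pe : e ∈ E}`. -/
def LTrans (p : H) (E : Set H) : Set H := Hmul p '' E

/-- The α-flat cone `fC(α) = {(x,y,0) : |y| < α|x|}`. -/
def fC (α : ℝ) : Set H := {p | |p.2.1| < α * |p.1| ∧ p.2.2 = 0}

/-- The α-full cone `C(α) = {(x,y,z) : |y| < α|x|, |z| < αx²/2}`. -/
def fullC (α : ℝ) : Set H := {p | |p.2.1| < α * |p.1| ∧ |p.2.2| < α * p.1 ^ 2 / 2}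

/-- The truncated full cone `C(β,r)`. -/
def truncC (β r : ℝ) : Set H :=
  {p | |p.2.1| < β * |p.1| ∧ |p.2.2| < β * p.1 ^ 2 / 2 ∧ |p.1| < r}

/-- The vertical set `vC(β,r) = {(x,0,ux²/2) : |u| < β, |x| < r}`. -/
def vC (β r : ℝ) : Set H :=
  {p | ∃ u x : ℝ, |u| < β ∧ |x| < r ∧ p = (x, 0, u * x ^ 2 / 2)}

/-- The shear map `M_t(x,y,z) = (x, y + tx, z)`. -/
def Mmap (t : ℝ) (p : H) : H := (p.1, p.2.1 + t * p.1, p.2.2)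

/-- The projection `π(x,y,z) = (y, z + xy/2)`. -/
def proj (p : H) : ℝ × ℝ := (p.2.1, p.2.2 + p.1 * p.2.1 / 2)

/-- The intrinsic graph of `φ` over `Ω`. -/
def IGraph (Ω : Set (ℝ × ℝ)) (φ : ℝ × ℝ → ℝ) : Set H :=
  (fun w => (φ w, w.1, w.2 - w.1 * φ w / 2)) '' Ω

/-- The α-flat cone property. -/
def FlatConeProp (α : ℝ) (S : Set H) : Prop :=
  ∀ p ∈ S, fC α ∩ LTrans (Hinv p) S = ∅

/-- A topological surface: every point of `S` has an open neighborhood in `S`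
homeomorphic to `ℝ²`. -/
def IsTopSurface (S : Set H) : Prop :=
  ∀ p : S, ∃ U : Set S, IsOpen U ∧ p ∈ U ∧ Nonempty (U ≃ₜ (ℝ × ℝ))

/-- Dilations `δ_λ(x,y,z) = (λx, λy, λ²z)`. -/
def dil (l : ℝ) (p : H) : H := (l * p.1, l * p.2.1, l ^ 2 * p.2.2)

/-- A cone is a set invariant under all dilations. -/
def IsCone (E : Set H) : Prop := ∀ l : ℝ, 0 < l → dil l '' E = E

/-- Rotation around the z-axis by angle θ. -/
def Rot (θ : ℝ) (p : H) : H :=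
  (p.1 * Real.cos θ - p.2.1 * Real.sin θ, p.1 * Real.sin θ + p.2.1 * Real.cos θ, p.2.2)

/-- A continuous map on the closed unit disc which is close to the identity on the unit circle
has a zero in the disc. -/
theorem exists_eq_zero_of_norm_sub_lt_one {h : ℂ → ℂ}
    (hc : ContinuousOn h (Metric.closedBall 0 1)) (hs : ∀ z, ‖z‖ = 1 → ‖h z - z‖ < 1) :
    ∃ z ∈ Metric.closedBall (0 : ℂ) 1, h z = 0 := by
  by_contra! hne
  let polar : ℝ × ℝ → ℂ := fun a => (max 0 (min a.1 1) : ℝ) * Circle.exp a.2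
  have polar_cont : Continuous polar := by fun_prop
  have polar_mem (a) : polar a ∈ Metric.closedBall (0 : ℂ) 1 := by
    simp [polar, abs_le]
  have comp_cont : Continuous fun a => h (polar a) := hc.comp_continuous polar_cont polar_mem
  let dir : C(ℝ × ℝ, Circle) :=
    ⟨fun a => ⟨h (polar a) / ‖h (polar a)‖, by
      have := norm_ne_zero_iff.2 (hne _ (polar_mem a))
      simp [Submonoid.unitSphere, this]⟩, by
      refine Continuous.subtype_mk (comp_cont.div
        (Complex.continuous_ofReal.comp comp_cont.norm) fun a => ?_) _
      exact Complex.ofReal_ne_zero.2 (norm_ne_zero_iff.2 (hne _ (polar_mem a)))⟩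
  have dir_apply (a) : (dir a : ℂ) = h (polar a) / ‖h (polar a)‖ := rfl
  obtain ⟨e₀, he₀⟩ := Circle.exp_surjective (dir (0, 0))
  obtain ⟨θ, ⟨-, hθ⟩, -⟩ := Circle.isCoveringMap_exp.existsUnique_continuousMap_lifts
    dir (0, 0) e₀ he₀
  have hθ (a) : Circle.exp (θ a) = dir a := congr_fun hθ a
  have const_of_exp {f : ℝ → ℝ} (hf : Continuous f)
      (he : ∀ s t, Circle.exp (f s) = Circle.exp (f t)) (s t : ℝ) : f s = f t :=
    Circle.isCoveringMap_exp.const_of_comp hf he s t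
  have dir_congr {a b} (hab : polar a = polar b) : dir a = dir b := by
    apply Subtype.ext
    simp only [dir_apply, hab]
  have zero_const (t) : θ (0, t) = θ (0, 0) := by
    refine const_of_exp (f := fun t => θ (0, t)) (by fun_prop) (fun s t => ?_) t 0
    simp only [hθ]
    exact dir_congr (by simp [polar])
  have periodic : θ (1, 2 * Real.pi) = θ (1, 0) := by
    have := const_of_exp (f := fun s => θ (s, 2 * Real.pi) - θ (s, 0)) (by fun_prop) (fun s t => by
      have (s : ℝ) : dir (s, 2 * Real.pi) = dir (s, 0) := dir_congr (by simp [polar])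
      simp [Circle.exp_sub, hθ, this]) 1 0
    simp only [zero_const (2 * Real.pi), sub_self] at this
    linarith
  have cos_pos (t : ℝ) : 0 < Real.cos (θ (1, t) - t) := by
    have hp : polar (1, t) = Circle.exp t := by simp [polar]
    have hn := hs (Circle.exp t) (by simp)
    have hz : h (Circle.exp t) ≠ 0 := by rw [← hp]; exact hne _ (polar_mem _)
    have h1 : Complex.exp ((θ (1, t) - t : ℝ) * Complex.I)
        = h (Circle.exp t) / ‖h (Circle.exp t)‖ / Circle.exp t := by
      have := congrArg (fun z : Circle => (z : ℂ)) (Circle.exp_sub (θ (1, t)) t)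
      simp only [hθ, Circle.coe_exp, Circle.coe_div] at this
      rw [this, dir_apply, hp, Circle.coe_exp]
    have h2 : Real.cos (θ (1, t) - t)
        = (h (Circle.exp t) / Circle.exp t).re / ‖h (Circle.exp t)‖ := by
      rw [← Complex.exp_ofReal_mul_I_re, h1, div_right_comm, Complex.div_ofReal_re]
    rw [h2]
    refine div_pos ?_ (norm_pos_iff.2 hz)
    have h3 : ‖h (Circle.exp t) / Circle.exp t - 1‖ < 1 := by
      have : h (Circle.exp t) / Circle.exp t - 1
          = (h (Circle.exp t) - Circle.exp t) / Circle.exp t := by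
        rw [sub_div, div_self (Circle.coe_ne_zero _)]
      rw [this, norm_div]
      simpa using hn
    have h4 := (Complex.abs_re_le_norm _).trans_lt h3
    rw [Complex.sub_re, Complex.one_re] at h4
    linarith [(abs_lt.1 h4).1]
  obtain ⟨t, -, ht⟩ := intermediate_value_Icc' (f := fun t => θ (1, t) - t)
    (by positivity : (0 : ℝ) ≤ 2 * Real.pi) (by fun_prop)
    (show θ (1, 0) - 0 - Real.pi ∈ _ by
      rw [periodic]; constructor <;> linarith [Real.pi_pos])
  have h1 := cos_pos t
  have h0 := cos_pos 0
  simp only at ht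
  rw [ht, Real.cos_sub_pi] at h1
  linarith

/-- **Invariance of domain** in the plane: an injective continuous map has a continuous local
section around each of its values. -/
theorem exists_local_section_of_injective {F : ℂ → ℂ} (hF : Continuous F)
    (hinj : Function.Injective F) :
    ∃ G : C(ℂ, ℂ), ∀ᶠ w in nhds (F 0), F (G w) = w := by
  have emb : Topology.IsClosedEmbedding (fun z : Metric.closedBall (0 : ℂ) 1 => F z) :=
    Continuous.isClosedEmbedding (by fun_prop) fun a b hab => Subtype.ext (hinj hab)
  obtain ⟨G, hG⟩ := ContinuousMap.exists_extension' emb ⟨Subtype.val, continuous_subtype_val⟩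
  have hG (z : ℂ) (hz : z ∈ Metric.closedBall (0 : ℂ) 1) : G (F z) = z := congr_fun hG ⟨z, hz⟩
  refine ⟨G, ?_⟩
  suffices F '' Metric.closedBall 0 1 ∈ nhds (F 0) by
    filter_upwards [this]
    rintro _ ⟨z, hz, rfl⟩
    rw [hG z hz]
  by_contra hnot
  have sphere_closed : IsClosed (F '' Metric.sphere 0 1) :=
    ((isCompact_sphere _ _).image hF).isClosed
  have zero_notMem : F 0 ∈ (F '' Metric.sphere 0 1)ᶜ := by
    rintro ⟨z, hz, hz0⟩
    simp [hinj hz0] at hz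
  obtain ⟨ε₂, ε₂_pos, hε₂⟩ := Metric.isOpen_iff.1 sphere_closed.isOpen_compl _ zero_notMem
  obtain ⟨ε, ε_pos, hε⟩ : ∃ ε > 0, ε₂ = 2 * ε := ⟨ε₂ / 2, by positivity, by ring⟩
  obtain ⟨c, hcε, hcK⟩ : ∃ c, dist c (F 0) < ε ∧ c ∉ F '' Metric.closedBall 0 1 := by
    by_contra! H
    exact hnot (Metric.mem_nhds_iff.2 ⟨ε, ε_pos, fun w hw => H w hw⟩)
  have far_sphere (z : ℂ) (hz : ‖z‖ = 1) : ε ≤ ‖F z - c‖ := by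
    by_contra! H
    refine hε₂ (a := F z) ?_ ⟨z, by simpa using hz, rfl⟩
    rw [← dist_eq_norm] at H
    rw [Metric.mem_ball]
    linarith [dist_triangle (F z) c (F 0)]
  obtain ⟨δ₀, δ₀_pos, hδ₀⟩ := Metric.isOpen_iff.1
    (isOpen_lt (f := fun z => ‖F z - c‖) (g := fun _ => ε) (by fun_prop) (by fun_prop)) 0
    (by rw [dist_comm, dist_eq_norm] at hcε; exact hcε)
  obtain ⟨δ, δ_pos, δ_le_one, hδ⟩ : ∃ δ > 0, δ ≤ 1 ∧ ∀ z, ε ≤ ‖F z - c‖ → δ ≤ ‖z‖ := by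
    refine ⟨min δ₀ 1, by positivity, min_le_right _ _, fun z hz => ?_⟩
    by_contra! H
    exact absurd (hδ₀ (a := z) (by simpa using H.trans_le (min_le_left _ _))) (not_lt.2 hz)
  obtain ⟨P, hP, hPG, -⟩ := G.continuous.exists_contDiff_approx 1 (ε := fun _ => δ / 2)
    continuous_const (fun _ => by positivity)
  have circle_smooth : ContDiff ℝ 1 fun t : ℝ => P (circleMap c ε t) :=
    hP.comp (contDiff_circleMap c ε)
  obtain ⟨v, hv, hvδ⟩ := (circle_smooth.dense_compl_range_of_finrank_lt_finrank
    (by simp)).exists_dist_lt 0 (half_pos δ_pos)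
  have close (w) : ‖P w - v - G w‖ < δ := by
    have h1 := hPG w
    rw [dist_eq_norm] at h1
    rw [dist_zero_left] at hvδ
    calc ‖P w - v - G w‖ = ‖(P w - G w) - v‖ := by congr 1; ring
      _ ≤ ‖P w - G w‖ + ‖v‖ := norm_sub_le _ _
      _ < δ := by linarith
  let push : ℂ → ℂ := fun w => c + (max 1 (ε / ‖w - c‖) : ℝ) * (w - c)
  have push_far {w : ℂ} (hw : ε ≤ ‖w - c‖) : push w = w := by
    have : ε / ‖w - c‖ ≤ 1 := div_le_one_of_le₀ hw (norm_nonneg _)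
    simp [push, max_eq_left this]
  have hne (z : ℂ) (hz : z ∈ Metric.closedBall (0 : ℂ) 1) : F z - c ≠ 0 := fun H =>
    hcK ⟨z, hz, sub_eq_zero.1 H⟩
  obtain ⟨z, hz, hz0⟩ := exists_eq_zero_of_norm_sub_lt_one (h := fun z => P (push (F z)) - v)
    (by
      refine (hP.continuous.comp_continuousOn ?_).sub continuousOn_const
      refine continuousOn_const.add (ContinuousOn.mul ?_ (by fun_prop))
      refine Complex.continuous_ofReal.comp_continuousOn (ContinuousOn.sup continuousOn_const ?_)
      exact continuousOn_const.div (by fun_prop) fun z hz => norm_ne_zero_iff.2 (hne z hz))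
    (fun z hz => by
      have := close (F z)
      rw [hG z (by simp [hz])] at this
      rw [push_far (far_sphere z hz)]
      exact this.trans_le δ_le_one)
  by_cases hfar : ε ≤ ‖F z - c‖
  · have := close (F z)
    rw [push_far hfar] at hz0
    rw [hz0, hG z hz, zero_sub, norm_neg] at this
    exact absurd (hδ z hfar) (not_le.2 this)
  · push Not at hfar
    have hpos : 0 < ‖F z - c‖ := norm_pos_iff.2 (hne z hz)
    have : push (F z) ∈ Metric.sphere c |ε| := by
      have h1 : 1 ≤ ε / ‖F z - c‖ := (one_le_div hpos).2 hfar.le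
      simp only [push, max_eq_right h1]
      simp [hpos.ne']
    rw [← range_circleMap] at this
    obtain ⟨t, ht⟩ := this
    exact hv ⟨t, by simp only [ht]; exact sub_eq_zero.1 hz0⟩

/-- The point of the fiber of `proj` over `w` with first coordinate `x`. -/
def fiberPoint (x : ℝ) (w : ℝ × ℝ) : H := (x, w.1, w.2 - w.1 * x / 2)

theorem fiberPoint_proj (p : H) : fiberPoint p.1 (proj p) = p := by
  ext <;> simp [fiberPoint, proj]
  ring

theorem continuous_proj : Continuous proj := by
  unfold proj
  fun_prop

theorem Hinv_Hmul_cancel (p g : H) : Hmul (Hinv p) (Hmul p g) = g := by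
  ext <;> simp [Hmul, Hinv]
  ring

theorem Hmul_Hinv_cancel (p q : H) : Hmul p (Hmul (Hinv p) q) = q := by
  ext <;> simp [Hmul, Hinv]
  ring

theorem Hmul_assoc (p q r : H) : Hmul (Hmul p q) r = Hmul p (Hmul q r) := by
  ext <;> simp [Hmul] <;> ring

theorem FlatConeProp.Hmul_notMem {α : ℝ} {S : Set H} (hS : FlatConeProp α S) {p : H} (hp : p ∈ S)
    {a b : ℝ} (hab : |b| < α * |a|) : Hmul p (a, b, 0) ∉ S := fun hq =>
  (hS p hp).le ⟨⟨hab, rfl⟩, Hmul p (a, b, 0), hq, Hinv_Hmul_cancel _ _⟩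

theorem FlatConeProp.injOn_proj {α : ℝ} (hα : 0 < α) {S : Set H} (hS : FlatConeProp α S) :
    InjOn proj S := by
  intro p hp q hq hpq
  simp only [proj, Prod.mk.injEq] at hpq
  obtain ⟨hy, hz⟩ := hpq
  by_cases hx : p.1 = q.1
  · rw [hx, hy] at hz
    exact Prod.ext hx (Prod.ext hy (by linarith))
  · refine absurd ?_ (hS.Hmul_notMem hp (a := q.1 - p.1) (b := 0) ?_)
    · convert hq using 1
      rw [← hy] at hz
      ext <;> simp [Hmul]
      · exact hy
      · linarith
    · rw [abs_zero]
      exact mul_pos hα (abs_pos.2 (sub_ne_zero.2 (Ne.symm hx)))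

/-- A topological surface with the flat cone property is locally the intrinsic graph of a
continuous function. -/
theorem IsTopSurface.exists_graph {α : ℝ} (hα : 0 < α) {S : Set H} (hS : IsTopSurface S)
    (hflat : FlatConeProp α S) {o : H} (ho : o ∈ S) :
    ∃ φ : ℝ × ℝ → ℝ, Continuous φ ∧ ∀ᶠ w in nhds (proj o), fiberPoint (φ w) w ∈ S := by
  obtain ⟨U, -, hoU, ⟨e⟩⟩ := hS ⟨o, ho⟩
  let E : ℂ ≃ₜ ℝ × ℝ := Complex.equivRealProdCLM.toHomeomorph
  let γ : ℂ → H := fun z => ((e.symm (E z + e ⟨⟨o, ho⟩, hoU⟩) : U) : S)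
  have γ_cont : Continuous γ := by fun_prop
  have γ_mem (z) : γ z ∈ S := Subtype.coe_prop _
  have γ_inj : Function.Injective γ := fun z w hzw => by
    simpa using e.symm.injective (Subtype.ext (Subtype.ext hzw))
  have γ_zero : γ 0 = o := by
    have : E 0 = 0 := Complex.equivRealProdCLM.map_zero
    simp [γ, this]
  obtain ⟨G, hG⟩ := exists_local_section_of_injective (F := fun z => E.symm (proj (γ z)))
    (E.symm.continuous.comp (continuous_proj.comp γ_cont))
    (fun z w hzw => γ_inj (hflat.injOn_proj hα (γ_mem z) (γ_mem w) (E.symm.injective hzw)))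
  rw [γ_zero] at hG
  refine ⟨fun w => (γ (G (E.symm w))).1, by fun_prop, ?_⟩
  filter_upwards [E.symm.continuous.continuousAt.eventually hG] with w hw
  have hw' := E.symm.injective hw
  have := fiberPoint_proj (γ (G (E.symm w)))
  rw [hw'] at this
  rw [this]
  exact γ_mem _

/-- The two halves of the flat cone at a point of an intrinsic graph lie on different sides of
the graph. -/
theorem FlatConeProp.pos_of_mem_cone {α : ℝ} (hα : 0 < α) {S : Set H} (hS : FlatConeProp α S)
    {φ : ℝ × ℝ → ℝ} (hφ : Continuous φ) {p : H} (hp : p ∈ S) {a b : ℝ} (hab : |b| < α * |a|)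
    (hgraph : ∀ t ∈ Icc (0 : ℝ) 1, fiberPoint (φ (proj (Hmul p (a, t * b, 0))))
      (proj (Hmul p (a, t * b, 0))) ∈ S)
    (hgraph₀ : fiberPoint (φ (proj p)) (proj p) ∈ S) :
    0 < a * ((Hmul p (a, b, 0)).1 - φ (proj (Hmul p (a, b, 0)))) := by
  have ha : a ≠ 0 := by
    rintro rfl
    simp only [abs_zero, mul_zero] at hab
    exact absurd hab (not_lt.2 (abs_nonneg b))
  have proj_fiberPoint (x : ℝ) (w : ℝ × ℝ) : proj (fiberPoint x w) = w := by
    ext <;> simp [fiberPoint, proj]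
    ring
  let f : ℝ → ℝ := fun t =>
    a * ((Hmul p (a, t * b, 0)).1 - φ (proj (Hmul p (a, t * b, 0))))
  have f_cont : Continuous f := by
    have : Continuous fun t : ℝ => Hmul p (a, t * b, 0) := by unfold Hmul; fun_prop
    have := continuous_proj.comp this
    simp only [Function.comp_def] at this
    fun_prop
  have f_ne (t) (ht : t ∈ Icc (0 : ℝ) 1) : f t ≠ 0 := by
    intro h0
    have hx : φ (proj (Hmul p (a, t * b, 0))) = (Hmul p (a, t * b, 0)).1 := by
      rcases mul_eq_zero.1 h0 with h | h
      · exact absurd h ha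
      · linarith
    have hmem := hgraph t ht
    rw [hx, fiberPoint_proj] at hmem
    refine hS.Hmul_notMem hp (lt_of_le_of_lt ?_ hab) hmem
    rw [abs_mul, abs_of_nonneg ht.1]
    exact mul_le_of_le_one_left (abs_nonneg _) ht.2
  have f_zero : 0 < f 0 := by
    have h0 : φ (proj p) = p.1 :=
      congrArg Prod.fst (hS.injOn_proj hα hgraph₀ hp (proj_fiberPoint _ _))
    have h1 : proj (Hmul p (a, 0 * b, 0)) = proj p := by
      ext <;> simp [proj, Hmul]
      ring
    simp only [f, h1, h0]
    simp only [Hmul, add_sub_cancel_left]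
    exact mul_self_pos.2 ha
  by_contra! hle
  obtain ⟨t, ht, ht0⟩ := intermediate_value_Icc' zero_le_one f_cont.continuousOn
    (show (0 : ℝ) ∈ Icc (f 1) (f 0) from ⟨by simpa [f] using hle, f_zero.le⟩)
  exact f_ne t ht ht0

theorem stmt0 (α : ℝ) (hα : 0 < α) (S : Set H) (hS : IsTopSurface S)
    (hflat : FlatConeProp α S) :
    ∀ o ∈ S, ∃ U : Set H, IsOpen U ∧ o ∈ U ∧
      ∀ p ∈ S ∩ U, fullC (α / 4) ∩ LTrans (Hinv p) (S ∩ U) = ∅ := by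
  intro o ho
  obtain ⟨φ, hφ, hgraph⟩ := hS.exists_graph hα hflat ho
  have hcont : Continuous fun x : H × ℝ × ℝ => proj (Hmul x.1 (x.2.1, x.2.2, 0)) := by
    refine continuous_proj.comp ?_
    unfold Hmul
    fun_prop
  have hnear : ∀ᶠ x : H × ℝ × ℝ in nhds (o, 0, 0),
      fiberPoint (φ (proj (Hmul x.1 (x.2.1, x.2.2, 0))))
        (proj (Hmul x.1 (x.2.1, x.2.2, 0))) ∈ S := by
    refine hcont.continuousAt.eventually (p := fun w => fiberPoint (φ w) w ∈ S) ?_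
    simpa [Hmul] using hgraph
  obtain ⟨r, hr, hball⟩ := Metric.eventually_nhds_iff.1 hnear
  have hmem (p : H) (hp : dist p o < r) (a b : ℝ) (ha : |a| < r) (hb : |b| < r) :
      fiberPoint (φ (proj (Hmul p (a, b, 0)))) (proj (Hmul p (a, b, 0))) ∈ S :=
    hball (y := (p, a, b)) 
      (max_lt hp (max_lt (by simpa using ha) (by simpa using hb)))
  obtain ⟨s, hs, hsr, hsα⟩ : ∃ s > 0, s ≤ r ∧ α * s ≤ r :=
    ⟨min r (r / α), by positivity, min_le_left _ _, by
      calc α * min r (r / α) ≤ α * (r / α) := by gcongr; exact min_le_right _ _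
        _ = r := by field_simp⟩
  refine ⟨Metric.ball o s, Metric.isOpen_ball, Metric.mem_ball_self hs, ?_⟩
  rintro p ⟨hp, hpo⟩
  rw [Set.eq_empty_iff_forall_notMem]
  rintro g ⟨⟨hy, hz⟩, q, ⟨hq, hqo⟩, rfl⟩
  have hqg := Hmul_Hinv_cancel p q
  have hxs : |(Hmul (Hinv p) q).1| < 2 * s := by
    have h1 : |p.1 - o.1| < s := lt_of_le_of_lt (le_max_left _ _) hpo
    have h2 : |q.1 - o.1| < s := lt_of_le_of_lt (le_max_left _ _) hqo
    simp only [Hmul, Hinv]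
    rw [abs_lt] at *
    constructor <;> linarith [h1.1, h1.2, h2.1, h2.2]
  generalize Hmul (Hinv p) q = g at *
  obtain ⟨x, y, z⟩ := g
  simp only at hy hz hxs
  have hx : x ≠ 0 := by
    rintro rfl
    simp only [abs_zero, mul_zero] at hy
    exact absurd hy (not_lt.2 (abs_nonneg y))
  have hx' : 0 < |x| := abs_pos.2 hx
  have hzx : |2 * z / x| < α / 4 * |x| := by
    rw [abs_div, div_lt_iff₀ hx', abs_mul, abs_two, mul_assoc, abs_mul_abs_self]
    linarith
  have hy2 : |y / 2| < α / 8 * |x| := by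
    rw [abs_div, abs_two]
    linarith
  have hxa : |x / 2| = |x| / 2 := by rw [abs_div, abs_two]
  have hb₁ : |y / 2 - 2 * z / x| < α * |x / 2| := by
    rw [hxa]
    linarith [abs_sub (y / 2) (2 * z / x), mul_pos hα hx']
  have hb₂ : |-(y / 2 + 2 * z / x)| < α * |-(x / 2)| := by
    rw [abs_neg, abs_neg, hxa]
    linarith [abs_add_le (y / 2) (2 * z / x), mul_pos hα hx']
  have hmeet : Hmul q (-(x / 2), -(y / 2 + 2 * z / x), 0)
      = Hmul p (x / 2, y / 2 - 2 * z / x, 0) := by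
    rw [← hqg, Hmul_assoc]
    congr 1
    ext <;> simp [Hmul]
    · ring
    · ring
    · field_simp
      ring
  have side {p : H} (hp : p ∈ S) (hpo : p ∈ Metric.ball o s) {a b : ℝ} (ha : |a| < s)
      (hab : |b| < α * |a|) :
      0 < a * ((Hmul p (a, b, 0)).1 - φ (proj (Hmul p (a, b, 0)))) := by
    have hpo' : dist p o < r := lt_of_lt_of_le hpo hsr
    refine hflat.pos_of_mem_cone hα hφ hp hab (fun t ht => ?_) ?_
    · refine hmem p hpo' a (t * b) (ha.trans_le hsr) ?_
      rw [abs_mul, abs_of_nonneg ht.1]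
      calc t * |b| ≤ |b| := mul_le_of_le_one_left (abs_nonneg _) ht.2
        _ < α * |a| := hab
        _ ≤ α * s := by gcongr
        _ ≤ r := hsα
    · simpa [Hmul] using hmem p hpo' 0 0 (by simpa using hr) (by simpa using hr)
  have h₁ := side hp hpo (by rw [hxa]; linarith) hb₁
  have h₂ := side hq hqo (by rw [abs_neg, hxa]; linarith) hb₂
  rw [hmeet] at h₂
  linarith
end
end

section
/- Let α > 0 and let S ⊆ ℍ be a topological surface with the α-flat cone property and 0 ∈ S. Then there exist η₀, τ₀ > 0 such that, setting V₀ := π⁻¹([−η₀, η₀] × [−τ₀, τ₀]), for every t ∈ [−α/2, α/2] and every p ∈ S ∩ V₀ there exists a continuous function φ_{t,p} : [−η₀, η₀] × [−τ₀, τ₀] → ℝ with Γ_{φ_{t,p}} = M_t(p⁻¹S) ∩ V₀. -/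
open Set

noncomputable section

open Filter Topology

/-- A continuous map on a closed disc that is uniformly close to a translation
vanishes somewhere in the disc. -/
theorem exists_zero_of_near_translation {h : ℂ → ℂ} {c : ℂ} {R : ℝ} (hR : 0 < R)
    (hc : ContinuousOn h (Metric.closedBall c R))
    (hn : ∀ z ∈ Metric.closedBall c R, ‖h z - (z - c)‖ < R) :
    ∃ z ∈ Metric.closedBall c R, h z = 0 := by
  by_contra! hne
  have hRc : (R : ℂ) ≠ 0 := by exact_mod_cast hR.ne'
  set ρ : ℂ → ℂ := fun z => c + R * (z / (max 1 ‖z‖ : ℝ)) with hρ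
  have hmax : ∀ z : ℂ, (0 : ℝ) < max 1 ‖z‖ := fun z => lt_max_of_lt_left one_pos
  have hρc : Continuous ρ := by
    refine continuous_const.add (continuous_const.mul (continuous_id.div ?_ ?_))
    · exact Complex.continuous_ofReal.comp (continuous_const.max continuous_norm)
    · intro z
      exact_mod_cast (hmax z).ne'
  have hρm : ∀ z, ρ z ∈ Metric.closedBall c R := by
    intro z
    rw [mem_closedBall_iff_norm]
    simp only [hρ, add_sub_cancel_left, norm_mul, norm_div, Complex.norm_real, Real.norm_eq_abs,
      abs_of_pos hR, abs_of_pos (hmax z)]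
    exact mul_le_of_le_one_right hR.le ((div_le_one (hmax z)).2 (le_max_right _ _))
  have hgc : Continuous (h ∘ ρ) := hc.comp_continuous hρc hρm
  have hg0 : ∀ z, (h ∘ ρ) z ≠ 0 := fun z => hne _ (hρm z)
  obtain ⟨L, ⟨-, hL⟩, -⟩ := Complex.isCoveringMapOn_exp.existsUnique_continuousMap_lifts
    (⟨h ∘ ρ, hgc⟩ : C(ℂ, ℂ)) (a₀ := 0) (Complex.exp_log (hg0 0)) (fun a => hg0 a)
  have hexpL : ∀ z, Complex.exp (L z) = h (ρ z) := fun z => congrFun hL z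
  set u : ℝ → ℂ := fun θ => Complex.exp (θ * Complex.I) with hu
  have hucont : Continuous u := by fun_prop
  have hunorm : ∀ θ, ‖u θ‖ = 1 := fun θ => Complex.norm_exp_ofReal_mul_I θ
  have hu0 : ∀ θ, u θ ≠ 0 := fun θ => Complex.exp_ne_zero _
  have hρu : ∀ θ, ρ (u θ) = c + R * u θ := by
    intro θ
    simp [hρ, hunorm]
  set q : ℝ → ℂ := fun θ => h (ρ (u θ)) / (R * u θ) with hq
  have hqc : Continuous q :=
    (hgc.comp hucont).div (by fun_prop) (fun θ => mul_ne_zero hRc (hu0 θ))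
  have hq1 : ∀ θ, ‖q θ - 1‖ < 1 := by
    intro θ
    have h1 : q θ - 1 = (h (ρ (u θ)) - (ρ (u θ) - c)) / (R * u θ) := by
      have := hu0 θ
      rw [show q θ = h (ρ (u θ)) / (R * u θ) from rfl, show ρ (u θ) - c = R * u θ by simp [hρu]]
      field_simp
    rw [h1, norm_div, norm_mul, hunorm, Complex.norm_real, Real.norm_eq_abs, abs_of_pos hR,
      mul_one, div_lt_one hR]
    exact hn _ (hρm _)
  have hqs : ∀ θ, q θ ∈ Complex.slitPlane := by
    intro θ
    left
    have h1 := (Complex.abs_re_le_norm (q θ - 1)).trans_lt (hq1 θ)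
    rw [abs_lt] at h1
    simp at h1
    linarith [h1.1]
  set k : ℝ → ℂ := fun θ => L (u θ) - Complex.log (q θ) with hk
  have hkc : Continuous k := (L.continuous.comp hucont).sub (hqc.clog hqs)
  have hkexp : ∀ θ, Complex.exp (k θ) = R * u θ := by
    intro θ
    have hq0 : q θ ≠ 0 := Complex.slitPlane_ne_zero (hqs θ)
    have hhρ : h (ρ (u θ)) ≠ 0 := hg0 _
    have := hu0 θ
    rw [hk, Complex.exp_sub, Complex.exp_log hq0, hexpL, hq]
    field_simp
  have key : k = fun θ : ℝ => k 0 + θ * Complex.I := by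
    refine Complex.isCoveringMap_exp.eq_of_comp_eq hkc (by fun_prop) ?_ 0 (by simp)
    ext θ
    simp only [Function.comp_apply]
    rw [Complex.exp_add, hkexp, hkexp]
    simp [hu]
  have hper : k (2 * Real.pi) = k 0 := by
    have : u (2 * Real.pi) = u 0 := by
      simp [hu, Complex.exp_two_pi_mul_I]
    simp only [hk, hq, this]
  have h2 := congrFun key (2 * Real.pi)
  rw [hper] at h2
  simp [Real.pi_ne_zero] at h2

/-- An injective continuous map on a compact set of the plane has a left inverse which is
continuous on its whole target. -/
theorem exists_continuous_leftInvOn {Y : Type*} [TopologicalSpace Y] [T2Space Y] [NormalSpace Y]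
    {f : ℂ → Y} {D : Set ℂ} (hD : IsCompact D) (hf : ContinuousOn f D) (hinj : InjOn f D) :
    ∃ G : Y → ℂ, Continuous G ∧ LeftInvOn G f D := by
  have : CompactSpace D := isCompact_iff_compactSpace.1 hD
  have he : IsClosedEmbedding (D.domRestrict f) :=
    (continuousOn_iff_continuous_domRestrict.1 hf).isClosedEmbedding (injOn_iff_injective.1 hinj)
  obtain ⟨G, hG⟩ := ContinuousMap.exists_extension' he
    (⟨Subtype.val, continuous_subtype_val⟩ : C(D, ℂ))
  exact ⟨G, G.continuous, fun z hz => congrFun hG ⟨z, hz⟩⟩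

/-- Invariance of domain in the plane. -/
theorem image_closedBall_mem_nhds_of_injOn {f : ℂ → ℂ}
    (hf : ContinuousOn f (Metric.closedBall 0 1)) (hinj : InjOn f (Metric.closedBall 0 1)) :
    f '' Metric.closedBall 0 1 ∈ 𝓝 (f 0) := by
  have hD : IsCompact (Metric.closedBall (0 : ℂ) 1) := isCompact_closedBall 0 1
  have h0D : (0 : ℂ) ∈ Metric.closedBall (0 : ℂ) 1 := by simp
  set K := f '' Metric.closedBall 0 1
  have hK : IsCompact K := hD.image_of_continuousOn hf
  obtain ⟨G, hGc, hG⟩ := exists_continuous_leftInvOn hD hf hinj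
  have hG0 : G (f 0) = 0 := hG h0D
  by_contra hnot
  obtain ⟨r, hr, hGr⟩ : ∃ r > 0, ∀ y, ‖y - f 0‖ < r → ‖G y‖ < 1 / 10 := by
    obtain ⟨r, hr, hGr⟩ := Metric.continuousAt_iff.1 (hGc.continuousAt (x := f 0)) (1 / 10)
      (by norm_num)
    refine ⟨r, hr, fun y hy => ?_⟩
    have := hGr (by rwa [dist_eq_norm] : dist y (f 0) < r)
    rwa [hG0, dist_zero_right] at this
  set ε := r / 3 with hε
  have hεpos : 0 < ε := by positivity
  obtain ⟨c, hcball, hcK⟩ : ∃ c ∈ Metric.ball (f 0) ε, c ∉ K := by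
    by_contra! hsub
    exact hnot (mem_of_superset (Metric.ball_mem_nhds _ hεpos) hsub)
  rw [mem_ball_iff_norm] at hcball
  have hout : IsCompact (K \ Metric.ball c ε) := hK.diff Metric.isOpen_ball
  obtain ⟨δ, hδ0, hδ1, hδ⟩ :
      ∃ δ : ℝ, 0 < δ ∧ δ < 1 / 10 ∧ ∀ y ∈ K \ Metric.ball c ε, δ ≤ ‖G y‖ := by
    obtain ⟨δ, hδ0, hδ⟩ := hout.exists_forall_le' (a := 0) (f := fun y => ‖G y‖)
      hGc.norm.continuousOn (by
        rintro y ⟨⟨z, hz, rfl⟩, hy⟩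
        rw [norm_pos_iff, hG hz]
        rintro rfl
        exact hy (by rwa [mem_ball_iff_norm, norm_sub_rev]))
    exact ⟨min δ (1 / 20), by positivity, (min_le_right _ _).trans_lt (by norm_num),
      fun y hy => (min_le_left _ _).trans (hδ y hy)⟩
  obtain ⟨P, hP, hPG, -⟩ := hGc.exists_contDiff_approx (ε := fun _ => δ / 2) 1 continuous_const
    (fun _ => by positivity)
  have hcirc : ContDiff ℝ 1 (fun θ : ℝ => P (c + ε * Complex.exp (θ * Complex.I))) := by
    refine hP.comp (contDiff_const.add (contDiff_const.mul ?_))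
    exact (Complex.ofRealCLM.contDiff.mul contDiff_const).cexp
  have hdense := hcirc.dense_compl_range_of_finrank_lt_finrank
    (by simp [Complex.finrank_real_complex])
  obtain ⟨v, hv, hvδ⟩ := hdense.exists_dist_lt 0 (half_pos hδ0)
  rw [dist_zero_left] at hvδ
  have hPv : ∀ y, ‖P y - v - G y‖ < δ := by
    intro y
    calc ‖P y - v - G y‖ = ‖(P y - G y) - v‖ := by ring_nf
      _ ≤ ‖P y - G y‖ + ‖v‖ := norm_sub_le _ _
      _ < δ := by
        have := hPG y
        rw [dist_eq_norm] at this
        linarith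
  set Φ : ℂ → ℂ := fun y => c + (max (ε / ‖y - c‖) 1 : ℝ) * (y - c) with hΦ
  have hne : ∀ y ∈ K, ‖y - c‖ ≠ 0 := by
    intro y hy hyc
    rw [norm_eq_zero, sub_eq_zero] at hyc
    exact hcK (hyc ▸ hy)
  have hΦc : ContinuousOn Φ K := by
    have h1 : ContinuousOn (fun y : ℂ => ‖y - c‖) K := by fun_prop
    refine continuousOn_const.add (ContinuousOn.mul ?_ (by fun_prop))
    exact Complex.continuous_ofReal.comp_continuousOn
      (ContinuousOn.sup (continuousOn_const.div h1 hne) continuousOn_const)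
  have hΦout : ∀ y ∈ K, ε ≤ ‖y - c‖ → Φ y = y := by
    intro y hy h1
    have : max (ε / ‖y - c‖) 1 = 1 := max_eq_right (div_le_one_of_le₀ h1 (norm_nonneg _))
    simp [hΦ, this]
  have hΦin : ∀ y ∈ K, ‖y - c‖ < ε → ‖Φ y - c‖ = ε := by
    intro y hy h1
    have hpos : 0 < ‖y - c‖ := lt_of_le_of_ne (norm_nonneg _) (hne y hy).symm
    have : max (ε / ‖y - c‖) 1 = ε / ‖y - c‖ := max_eq_left ((one_le_div hpos).2 h1.le)
    simp only [hΦ, this, add_sub_cancel_left, norm_mul, Complex.norm_real, Real.norm_eq_abs]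
    rw [abs_of_pos (by positivity)]
    field_simp
  have hcomp : ContinuousOn (fun z => P (Φ (f z)) - v) (Metric.closedBall 0 1) :=
    (hP.continuous.comp_continuousOn (hΦc.comp hf (mapsTo_image _ _))).sub continuousOn_const
  obtain ⟨z, hz, hz0⟩ := exists_zero_of_near_translation one_pos hcomp (by
    intro z hz
    have hfz : f z ∈ K := mem_image_of_mem f hz
    rw [sub_zero]
    rcases le_or_gt ε ‖f z - c‖ with h1 | h1
    · rw [hΦout _ hfz h1]
      have := hPv (f z)
      rw [hG hz] at this
      linarith
    · have h2 : ‖G (f z)‖ < 1 / 10 := by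
        apply hGr
        have := norm_sub_le_norm_sub_add_norm_sub (f z) c (f 0)
        linarith
      have h3 : ‖G (Φ (f z))‖ < 1 / 10 := by
        apply hGr
        have := norm_sub_le_norm_sub_add_norm_sub (Φ (f z)) c (f 0)
        rw [hΦin _ hfz h1] at this
        linarith
      rw [hG hz] at h2
      have h4 := hPv (Φ (f z))
      calc ‖P (Φ (f z)) - v - z‖
          = ‖(P (Φ (f z)) - v - G (Φ (f z))) + G (Φ (f z)) - z‖ := by ring_nf
        _ ≤ ‖P (Φ (f z)) - v - G (Φ (f z))‖ + ‖G (Φ (f z))‖ + ‖z‖ :=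
          (norm_sub_le _ _).trans (by gcongr; exact norm_add_le _ _)
        _ < 1 := by linarith)
  have hfz : f z ∈ K := mem_image_of_mem f hz
  rcases le_or_gt ε ‖f z - c‖ with h1 | h1
  · have h2 := hPv (Φ (f z))
    rw [hz0, zero_sub, norm_neg, hΦout _ hfz h1] at h2
    refine h2.not_ge (hδ _ ⟨hfz, ?_⟩)
    rw [mem_ball_iff_norm]
    exact h1.not_gt
  · refine hv ⟨Complex.arg (Φ (f z) - c), ?_⟩
    have h2 := Complex.norm_mul_exp_arg_mul_I (Φ (f z) - c)
    rw [hΦin _ hfz h1] at h2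
    simp only [h2, add_sub_cancel]
    exact sub_eq_zero.1 hz0

/-- If one member of a continuous family of plane maps is injective on the unit disc, then the
images of the disc under nearby members cover a common neighbourhood. -/
theorem eventually_mem_image_closedBall {X : Type*} [TopologicalSpace X] {F : X → ℂ → ℂ}
    (hF : Continuous fun a : X × ℂ => F a.1 a.2) {x₀ : X}
    (hinj : InjOn (F x₀) (Metric.closedBall 0 1)) :
    ∀ᶠ a : X × ℂ in 𝓝 (x₀, F x₀ 0), a.2 ∈ F a.1 '' Metric.closedBall 0 1 := by
  have hD : IsCompact (Metric.closedBall (0 : ℂ) 1) := isCompact_closedBall 0 1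
  have hF₀ : Continuous (F x₀) := hF.comp (Continuous.prodMk_right x₀)
  obtain ⟨G, hGc, hG⟩ := exists_continuous_leftInvOn hD hF₀.continuousOn hinj
  obtain ⟨δ, hδ, hδK⟩ := Metric.nhds_basis_closedBall.mem_iff.1
    (image_closedBall_mem_nhds_of_injOn hF₀.continuousOn hinj)
  have hclose : ∀ᶠ x in 𝓝 x₀, ∀ z ∈ Metric.closedBall (0 : ℂ) 1, ‖F x z - F x₀ z‖ < δ / 2 := by
    refine hD.eventually_forall_of_forall_eventually fun z _ => ?_
    have hcont : Continuous fun a : X × ℂ => ‖F a.1 a.2 - F x₀ a.2‖ :=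
      (hF.sub (hF₀.comp continuous_snd)).norm
    refine hcont.continuousAt.eventually_lt continuousAt_const ?_
    simpa using half_pos hδ
  rw [nhds_prod_eq]
  filter_upwards [hclose.prod_mk (Metric.ball_mem_nhds (F x₀ 0) (half_pos hδ))]
  rintro ⟨x, w⟩ ⟨hx, hw⟩
  have hw' : ‖w - F x₀ 0‖ < δ / 2 := by simpa [dist_eq_norm] using hw
  obtain ⟨y, hy, hy0⟩ := exists_zero_of_near_translation (h := fun y => F x (G y) - w) hδ
    (Continuous.continuousOn (by
      exact ((hF.comp (Continuous.prodMk_right x)).comp hGc).sub continuous_const)) (by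
    intro y hy
    obtain ⟨z, hz, rfl⟩ := hδK hy
    simp only [hG hz]
    calc ‖F x z - w - (F x₀ z - F x₀ 0)‖ = ‖(F x z - F x₀ z) - (w - F x₀ 0)‖ := by ring_nf
      _ ≤ ‖F x z - F x₀ z‖ + ‖w - F x₀ 0‖ := norm_sub_le _ _
      _ < δ := by linarith [hx z hz])
  obtain ⟨z, hz, rfl⟩ := hδK hy
  exact ⟨G (F x₀ z), by rwa [hG hz], sub_eq_zero.1 hy0⟩

/-- The composition of the intrinsic projection, a shear and a left translation. -/
def shearProj (t : ℝ) (p q : H) : ℝ × ℝ := proj (Mmap t (Hmul (Hinv p) q))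

theorem continuous_shearProj : Continuous fun a : (ℝ × H) × H => shearProj a.1.1 a.1.2 a.2 := by
  unfold shearProj proj Mmap Hmul Hinv
  fun_prop

theorem shearProj_zero (q : H) : shearProj 0 (0, 0, 0) q = proj q := by
  simp [shearProj, proj, Mmap, Hmul, Hinv]

theorem shearProj_zero_zero (t : ℝ) : shearProj t (0, 0, 0) (0, 0, 0) = (0, 0) := by
  simp [shearProj, proj, Mmap, Hmul, Hinv]

/-- A point of a set with the flat cone property is determined by its sheared projection. -/
theorem FlatConeProp.injOn_shearProj {α : ℝ} (hα : 0 < α) {S : Set H} (hS : FlatConeProp α S)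
    {t : ℝ} (ht : t ∈ Icc (-(α / 2)) (α / 2)) (p : H) : InjOn (shearProj t p) S := by
  rintro ⟨x, y, z⟩ hq ⟨x', y', z'⟩ hq' h
  have hdisj := hS _ hq
  rw [eq_empty_iff_forall_notMem] at hdisj
  have hnot := hdisj (Hmul (Hinv (x, y, z)) (x', y', z'))
  obtain ⟨a, b, c⟩ := p
  simp only [shearProj, proj, Mmap, Hmul, Hinv, Prod.mk.injEq] at h
  obtain ⟨h1, h2⟩ := h
  have hy : y' - y = -t * (x' - x) := by linarith
  obtain rfl : y' = y + -t * (x' - x) := by linarith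
  have hz : -z + z' + (-x * (y + -t * (x' - x)) - x' * -y) / 2 = 0 := by
    rw [show -b + (y + -t * (x' - x)) + t * (-a + x') = -b + y + t * (-a + x) by ring] at h2
    linear_combination -h2
  have hx : x' = x := by
    by_contra hne
    refine hnot ⟨⟨?_, hz⟩, mem_image_of_mem _ hq'⟩
    simp only [Hmul, Hinv]
    rw [show -y + (y + -t * (x' - x)) = -t * (x' - x) by ring,
      show -x + x' = x' - x by ring, abs_mul, abs_neg]
    have hpos : 0 < |x' - x| := abs_pos.2 (sub_ne_zero.2 hne)
    have : |t| ≤ α / 2 := abs_le.2 ht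
    exact mul_lt_mul_of_pos_right (by linarith) hpos
  subst hx
  simp only [sub_self, mul_zero, add_zero, Prod.mk.injEq, true_and] at hz ⊢
  linarith

/-- A topological surface through a point contains an injectively parametrized disc centred
there. -/
theorem IsTopSurface.exists_parametrization {S : Set H} (hS : IsTopSurface S) {p : H}
    (hp : p ∈ S) :
    ∃ ψ : ℂ → H, Continuous ψ ∧ Function.Injective ψ ∧ ψ 0 = p ∧ ∀ z, ψ z ∈ S := by
  obtain ⟨U, -, hU, ⟨e⟩⟩ := hS ⟨p, hp⟩
  refine ⟨fun z => (e.symm (Complex.equivRealProdCLM z + e ⟨_, hU⟩) : S), ?_, ?_, ?_,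
    fun z => Subtype.coe_prop _⟩
  · exact continuous_subtype_val.comp (continuous_subtype_val.comp
      (e.symm.continuous.comp (by fun_prop)))
  · exact Subtype.val_injective.comp (Subtype.val_injective.comp
      (e.symm.injective.comp ((add_left_injective _).comp Complex.equivRealProdCLM.injective)))
  · simp only [map_zero, zero_add, e.symm_apply_apply]

theorem Icc_neg_prod_Icc_neg (r : ℝ) :
    Icc (-r) r ×ˢ Icc (-r) r = Metric.closedBall ((0 : ℝ), (0 : ℝ)) r := by
  rw [← closedBall_prod_same, Real.closedBall_eq_Icc, zero_sub, zero_add]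

theorem stmt9 (α : ℝ) (hα : 0 < α) (S : Set H) (hS : IsTopSurface S)
    (hflat : FlatConeProp α S) (h0 : ((0:ℝ), (0:ℝ), (0:ℝ)) ∈ S) :
    ∃ η₀ > 0, ∃ τ₀ > 0,
      ∀ t ∈ Icc (-(α / 2)) (α / 2),
        ∀ p ∈ S ∩ proj ⁻¹' (Icc (-η₀) η₀ ×ˢ Icc (-τ₀) τ₀),
          ∃ φ : ℝ × ℝ → ℝ, ContinuousOn φ (Icc (-η₀) η₀ ×ˢ Icc (-τ₀) τ₀) ∧
            IGraph (Icc (-η₀) η₀ ×ˢ Icc (-τ₀) τ₀) φ =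
              (Mmap t '' LTrans (Hinv p) S) ∩
                proj ⁻¹' (Icc (-η₀) η₀ ×ˢ Icc (-τ₀) τ₀) := by
  obtain ⟨ψ, hψc, hψi, hψ0, hψS⟩ := hS.exists_parametrization h0
  set D : Set ℂ := Metric.closedBall 0 1
  have hD : IsCompact D := isCompact_closedBall 0 1
  have hcover : ∀ᶠ a : H × ℝ × ℝ in 𝓝 ((0, 0, 0), (0, 0)), ∀ t ∈ Icc (-(α / 2)) (α / 2),
      ∃ z ∈ D, shearProj t a.1 (ψ z) = a.2 := by
    refine isCompact_Icc.eventually_forall_of_forall_eventually fun t ht => ?_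
    let F : ℝ × H → ℂ → ℂ := fun x z => Complex.equivRealProdCLM.symm (shearProj x.1 x.2 (ψ z))
    have hF : Continuous fun a : (ℝ × H) × ℂ => F a.1 a.2 :=
      Complex.equivRealProdCLM.symm.continuous.comp (continuous_shearProj.comp
        (continuous_fst.prodMk (hψc.comp continuous_snd)))
    have hev := eventually_mem_image_closedBall hF (x₀ := (t, ((0, 0, 0) : H))) (by
      intro z _ z' _ h
      exact hψi (hflat.injOn_shearProj hα ht _ (hψS z) (hψS z')
        (Complex.equivRealProdCLM.symm.injective h)))
    have hF0 : F (t, (0, 0, 0)) 0 = Complex.equivRealProdCLM.symm (0, 0) := by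
      simp only [F, hψ0, shearProj_zero_zero]
    rw [hF0] at hev
    have hcont : Continuous fun a : (H × ℝ × ℝ) × ℝ =>
        ((a.2, a.1.1), Complex.equivRealProdCLM.symm a.1.2) := by fun_prop
    filter_upwards [(hcont.tendsto (((0, 0, 0), (0, 0)), t)).eventually hev]
    rintro ⟨⟨p, w⟩, s⟩ ⟨z, hz, h⟩
    exact ⟨z, hz, Complex.equivRealProdCLM.symm.injective h⟩
  rw [nhds_prod_eq, eventually_prod_iff] at hcover
  obtain ⟨A, hA, B, hB, hAB⟩ := hcover
  dsimp only at hAB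
  have hA0 : A (0, 0, 0) := hA.self_of_nhds
  have hproj : Continuous proj := by
    unfold proj
    fun_prop
  have h0mem : (0 : ℝ) ∈ Icc (-(α / 2)) (α / 2) := by
    constructor <;> linarith
  have hprojinj : InjOn proj S := by
    have := hflat.injOn_shearProj hα h0mem (0, 0, 0)
    rwa [show shearProj 0 (0, 0, 0) = proj from funext shearProj_zero] at this
  have hfar : ∀ᶠ w : ℝ × ℝ in 𝓝 (0, 0), w ∉ proj '' (ψ '' D \ interior {p | A p}) := by
    have hcpt : IsCompact (proj '' (ψ '' D \ interior {p | A p})) :=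
      ((hD.image hψc).diff isOpen_interior).image hproj
    refine hcpt.isClosed.isOpen_compl.mem_nhds ?_
    rintro ⟨_, ⟨⟨z, _, rfl⟩, hint⟩, hz0⟩
    have : ψ z = (0, 0, 0) := hprojinj (hψS z) h0 (by simpa [proj] using hz0)
    exact hint (this ▸ mem_interior_iff_mem_nhds.2 hA)
  obtain ⟨r, hr, hrQ⟩ := Metric.nhds_basis_closedBall.eventually_iff.1 (hB.and hfar)
  refine ⟨r, hr, r, hr, ?_⟩
  rw [Icc_neg_prod_Icc_neg]
  rintro t ht p ⟨hpS, hpQ⟩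
  have hAp : A p := by
    obtain ⟨z, hz, hzp⟩ := hAB hA0 (hrQ hpQ).1 0 h0mem
    rw [shearProj_zero] at hzp
    have hzp' : ψ z = p := hprojinj (hψS z) hpS hzp
    by_contra hnA
    refine (hrQ hpQ).2 ⟨p, ⟨⟨z, hz, hzp'⟩, fun hint => hnA (interior_subset hint)⟩, rfl⟩
  have hinj := hflat.injOn_shearProj hα ht p
  have hsc : Continuous fun z => shearProj t p (ψ z) :=
    continuous_shearProj.comp ((Continuous.prodMk_right (t, p)).comp hψc)
  obtain ⟨G, hGc, hG⟩ := exists_continuous_leftInvOn (f := fun z => shearProj t p (ψ z)) hD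
    hsc.continuousOn
    (fun z _ z' _ h => hψi (hinj (hψS z) (hψS z') h))
  have hpoint : ∀ a : H, (a.1, (proj a).1, (proj a).2 - (proj a).1 * a.1 / 2) = a := by
    rintro ⟨x, y, z⟩
    simp only [proj, Prod.mk.injEq, true_and]
    ring
  refine ⟨fun w => (Mmap t (Hmul (Hinv p) (ψ (G w)))).1, ?_, ?_⟩
  · simp only [Mmap, Hmul]
    exact (continuous_const.add (continuous_fst.comp (hψc.comp hGc))).continuousOn
  · ext a
    constructor
    · rintro ⟨w, hw, rfl⟩
      obtain ⟨z, hz, rfl⟩ := hAB hAp (hrQ hw).1 t ht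
      have hGz : G (shearProj t p (ψ z)) = z := hG hz
      simp only [hGz]
      rw [shearProj, hpoint]
      exact ⟨mem_image_of_mem _ (mem_image_of_mem _ (hψS z)), hw⟩
    · rintro ⟨⟨_, ⟨q, hq, rfl⟩, rfl⟩, hw⟩
      obtain ⟨z, hz, hzq⟩ := hAB hAp (hrQ hw).1 t ht
      have hqz : ψ z = q := hinj (hψS z) hq hzq
      subst hqz
      have hGz : G (shearProj t p (ψ z)) = z := hG hz
      refine ⟨shearProj t p (ψ z), hw, ?_⟩
      simp only [hGz]
      exact hpoint (Mmap t (Hmul (Hinv p) (ψ z)))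
end
end
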